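/- Assume p, q ≥ 2 and s' ∉ {−s, ((p−1)/(q−1))·s}. Then the smallest linear subspace of M_{n+2}(ℝ) containing all curvature values κ(X,Y), X,Y ∈ 𝔥, and invariant under M ↦ [α(Z),M] for every Z ∈ 𝔥, equals all of 𝔤 = so(J). (Wang-holonomy form of: for a generic ratio of radii the conformal holonomy of S^p × S^q is full, namely so(p+q+1,1) for s' > 0 and so(p+1,q+1) for s' < 0.) -/

import Mathlib

open Matrix

noncomputable section

/-- The sign `sgn(s')` of a (nonzero) real number. -/
def sgn (s' : ℝ) : ℝ := if 0 < s' then 1 else -1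

/-- Index type of `ℝⁿ`, `n = p + q`. -/
abbrev NIdx (p q : ℕ) := Fin p ⊕ Fin q

/-- Index type for block matrices of block sizes `1, n, 1` with `n = p + q`. -/
abbrev BigIdx (p q : ℕ) := (Fin 1 ⊕ (Fin p ⊕ Fin q)) ⊕ Fin 1

/-- Elements of `𝔥 = so(p+1) × so(q+1)`, written as pairs of `(1+p)`- and
`(1+q)`-indexed matrices. -/
abbrev HElt (p q : ℕ) :=
  Matrix (Fin 1 ⊕ Fin p) (Fin 1 ⊕ Fin p) ℝ × Matrix (Fin 1 ⊕ Fin q) (Fin 1 ⊕ Fin q) ℝ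

/-- Membership in `𝔥 = so(p+1) × so(q+1)`: both components are skew-symmetric. -/
def skewPair (p q : ℕ) (X : HElt p q) : Prop := X.1ᵀ = -X.1 ∧ X.2ᵀ = -X.2

/-- The componentwise commutator bracket of `𝔥 = so(p+1) × so(q+1)`. -/
def hBracket (p q : ℕ) (X Y : HElt p q) : HElt p q :=
  (X.1 * Y.1 - Y.1 * X.1, X.2 * Y.2 - Y.2 * X.2)

/-- `𝐠 = diag(I_p, ε I_q)`, `ε = sgn s'`. -/
def gMat (p q : ℕ) (s' : ℝ) : Matrix (NIdx p q) (NIdx p q) ℝ :=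
  fromBlocks 1 0 0 (sgn s' • 1)

/-- `J = [[0,0,1],[0,𝐠,0],[1,0,0]]` (block sizes `1, n, 1`), so that
`𝔤 = so(J) = {M : MᵗJ + JM = 0}`. -/
def JMat (p q : ℕ) (s' : ℝ) : Matrix (BigIdx p q) (BigIdx p q) ℝ :=
  fromBlocks
    (fromBlocks 0 0 0 (gMat p q s'))
    (Matrix.of fun i _ => Sum.elim (fun _ => (1 : ℝ)) (fun _ => 0) i)
    (Matrix.of fun _ j => Sum.elim (fun _ => (1 : ℝ)) (fun _ => 0) j)
    0

/-- The rho-tensor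
`𝔸 = −(1/(2δ))((2sΔ+m)·diag(I_p,0) + (2s'Δ−m)·ε·diag(0,I_q))`, where
`δ = (n−1)(n−2)`, `Δ = (p−1)(q−1)`, `m = s·p(p−1) − s'·q(q−1)`, `ε = sgn s'`. -/
def AMat (p q : ℕ) (s s' : ℝ) : Matrix (NIdx p q) (NIdx p q) ℝ :=
  (-(1 / (2 * (((p : ℝ) + (q : ℝ) - 1) * ((p : ℝ) + (q : ℝ) - 2))))) •
    ((2 * s * (((p : ℝ) - 1) * ((q : ℝ) - 1)) +
        (s * p * ((p : ℝ) - 1) - s' * q * ((q : ℝ) - 1))) •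
      (fromBlocks 1 0 0 0 : Matrix (NIdx p q) (NIdx p q) ℝ) +
     ((2 * s' * (((p : ℝ) - 1) * ((q : ℝ) - 1)) -
        (s * p * ((p : ℝ) - 1) - s' * q * ((q : ℝ) - 1))) * sgn s') •
      (fromBlocks 0 0 0 1 : Matrix (NIdx p q) (NIdx p q) ℝ))

/-- The `ℝᵐ`-component `v` of an element `[[0,−vᵗ],[v,A]]` of `so(m+1)`. -/
def vPart {m : ℕ} (P : Matrix (Fin 1 ⊕ Fin m) (Fin 1 ⊕ Fin m) ℝ) : Fin m → ℝ :=
  fun i => P (Sum.inr i) (Sum.inl 0)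

/-- `x := (v/√s, w/√|s'|) ∈ ℝⁿ` for `X = (v ⊕ A₁, w ⊕ A₂) ∈ 𝔥`. -/
def xVec (p q : ℕ) (s s' : ℝ) (X : HElt p q) : NIdx p q → ℝ :=
  Sum.elim (fun i => vPart X.1 i / Real.sqrt s) (fun j => vPart X.2 j / Real.sqrt |s'|)

/-- The invariant Cartan connection `α : 𝔥 → 𝔤`: for `X = (v ⊕ A₁, w ⊕ A₂)` and
`x = (v/√s, w/√|s'|)`, `α(X)` is the block matrix (block sizes `1, n, 1`) with
`(1,2)`-block `xᵗ𝔸`, `(2,1)`-block `x`, `(2,2)`-block `diag(A₁,A₂)`,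
`(2,3)`-block `−𝐠𝔸x`, `(3,2)`-block `−xᵗ𝐠`, and all other blocks zero. -/
def alphaMap (p q : ℕ) (s s' : ℝ) (X : HElt p q) :
    Matrix (BigIdx p q) (BigIdx p q) ℝ :=
  fromBlocks
    (fromBlocks 0
      (Matrix.of fun _ j => Matrix.vecMul (xVec p q s s' X) (AMat p q s s') j)
      (Matrix.of fun i _ => xVec p q s s' X i)
      (fromBlocks (toBlocks₂₂ X.1) 0 0 (toBlocks₂₂ X.2)))
    (Matrix.of fun i _ => Sum.elim (fun _ => (0 : ℝ))
      (fun k => -(Matrix.mulVec (gMat p q s' * AMat p q s s') (xVec p q s s' X) k)) i)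
    (Matrix.of fun _ j => Sum.elim (fun _ => (0 : ℝ))
      (fun k => -(Matrix.vecMul (xVec p q s s' X) (gMat p q s') k)) j)
    0

/-- The curvature `κ(X,Y) = [α(X),α(Y)] − α([X,Y])` of the Cartan connection `α`. -/
def kappaMap (p q : ℕ) (s s' : ℝ) (X Y : HElt p q) :
    Matrix (BigIdx p q) (BigIdx p q) ℝ :=
  alphaMap p q s s' X * alphaMap p q s s' Y - alphaMap p q s s' Y * alphaMap p q s s' X -
    alphaMap p q s s' (hBracket p q X Y)

section Wedge

variable {ι : Type*} [Fintype ι]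

/-- The endomorphism `x ↦ ⟨v, x⟩ u - ⟨u, x⟩ v` attached to the bilinear form with matrix `J`. -/
def wedge (J : Matrix ι ι ℝ) (u v : ι → ℝ) : Matrix ι ι ℝ :=
  vecMulVec u (J *ᵥ v) - vecMulVec v (J *ᵥ u)

theorem wedge_swap (J : Matrix ι ι ℝ) (u v : ι → ℝ) : wedge J u v = -wedge J v u := by
  simp [wedge]

theorem wedge_self (J : Matrix ι ι ℝ) (u : ι → ℝ) : wedge J u u = 0 := by
  simp [wedge]

theorem wedge_add_right (J : Matrix ι ι ℝ) (u v w : ι → ℝ) :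
    wedge J u (v + w) = wedge J u v + wedge J u w := by
  simp only [wedge, mulVec_add, vecMulVec_add, add_vecMulVec]
  abel

theorem wedge_smul_right (J : Matrix ι ι ℝ) (u v : ι → ℝ) (c : ℝ) :
    wedge J u (c • v) = c • wedge J u v := by
  simp only [wedge, mulVec_smul, vecMulVec_smul, smul_vecMulVec, smul_sub]

theorem wedge_add_left (J : Matrix ι ι ℝ) (u v w : ι → ℝ) :
    wedge J (u + v) w = wedge J u w + wedge J v w := by
  rw [wedge_swap, wedge_add_right, wedge_swap J u, wedge_swap J v]
  abel

theorem wedge_smul_left (J : Matrix ι ι ℝ) (u v : ι → ℝ) (c : ℝ) :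
    wedge J (c • u) v = c • wedge J u v := by
  rw [wedge_swap, wedge_smul_right, wedge_swap J u, smul_neg]

theorem wedge_mulVec (J : Matrix ι ι ℝ) (u v w : ι → ℝ) :
    wedge J u v *ᵥ w = ((J *ᵥ v) ⬝ᵥ w) • u - ((J *ᵥ u) ⬝ᵥ w) • v := by
  ext i
  simp [wedge, sub_mulVec, vecMulVec_mulVec, mul_comm]

/-- Skew-adjoint matrices act on wedges as derivations. -/
theorem commutator_wedge {J M : Matrix ι ι ℝ} (hM : Mᵀ * J + J * M = 0) (u v : ι → ℝ) :
    M * wedge J u v - wedge J u v * M = wedge J (M *ᵥ u) v + wedge J u (M *ᵥ v) := by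
  have h (x : ι → ℝ) : (J *ᵥ x) ᵥ* M = -(J *ᵥ (M *ᵥ x)) := by
    rw [← mulVec_transpose, mulVec_mulVec, mulVec_mulVec, eq_neg_iff_add_eq_zero, ← add_mulVec,
      hM, zero_mulVec]
  simp only [wedge, mul_sub, sub_mul, mul_vecMulVec, vecMulVec_mul, h, vecMulVec_neg]
  abel

theorem wedge_skew {J : Matrix ι ι ℝ} (hJ : Jᵀ = J) (u v : ι → ℝ) :
    (wedge J u v)ᵀ * J + J * wedge J u v = 0 := by
  have h (x : ι → ℝ) : x ᵥ* J = J *ᵥ x := by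
    conv_lhs => rw [← hJ]
    rw [vecMul_transpose]
  simp only [wedge, transpose_sub, transpose_vecMulVec, sub_mul, mul_sub, mul_vecMulVec,
    vecMulVec_mul, h]
  abel

/-- The commutator of two skew-adjoint matrices is skew-adjoint. -/
theorem commutator_skew {J A B : Matrix ι ι ℝ} (hA : Aᵀ * J + J * A = 0)
    (hB : Bᵀ * J + J * B = 0) : (A * B - B * A)ᵀ * J + J * (A * B - B * A) = 0 := by
  rw [← eq_neg_iff_add_eq_zero] at hA hB
  have h1 : Bᵀ * Aᵀ * J = J * (B * A) := by
    rw [mul_assoc, hA, mul_neg, ← mul_assoc, hB, neg_mul, neg_neg, mul_assoc]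
  have h2 : Aᵀ * Bᵀ * J = J * (A * B) := by
    rw [mul_assoc, hB, mul_neg, ← mul_assoc, hA, neg_mul, neg_neg, mul_assoc]
  rw [transpose_sub, transpose_mul, transpose_mul, sub_mul, h1, h2, mul_sub]
  abel

/-- The commutator of two wedges, in terms of the bilinear form. -/
theorem commutator_wedge_wedge {J : Matrix ι ι ℝ} (hJ : Jᵀ = J) (u v x y : ι → ℝ) :
    wedge J u v * wedge J x y - wedge J x y * wedge J u v =
      wedge J (((J *ᵥ v) ⬝ᵥ x) • u - ((J *ᵥ u) ⬝ᵥ x) • v) y +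
        wedge J x (((J *ᵥ v) ⬝ᵥ y) • u - ((J *ᵥ u) ⬝ᵥ y) • v) := by
  rw [commutator_wedge (wedge_skew hJ u v), wedge_mulVec, wedge_mulVec]

/-- For an involutive symmetric `J`, a space containing the wedges of the images under `J` of all
coordinate vectors contains every matrix skew-adjoint for `J`. -/
theorem mem_of_wedge_mem [DecidableEq ι] {J : Matrix ι ι ℝ} (hJ : Jᵀ = J) (hJJ : J * J = 1)
    (H : Submodule ℝ (Matrix ι ι ℝ))
    (hH : ∀ i j, wedge J (J *ᵥ Pi.single i 1) (J *ᵥ Pi.single j 1) ∈ H)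
    {M : Matrix ι ι ℝ} (hM : Mᵀ * J + J * M = 0) : M ∈ H := by
  have hS : (J * M)ᵀ = -(J * M) := by
    rw [transpose_mul, hJ, eq_neg_iff_add_eq_zero, hM]
  have hw (i j : ι) : wedge J (J *ᵥ Pi.single i 1) (J *ᵥ Pi.single j 1) =
      J * (single i j 1 - single j i 1) := by
    simp only [wedge, mulVec_mulVec, hJJ, one_mulVec, mul_sub, single_eq_single_vecMulVec_single,
      mul_vecMulVec]
  have hsum : M = (1 / 2 : ℝ) • ∑ i, ∑ j, (J * M) i j •
      wedge J (J *ᵥ Pi.single i 1) (J *ᵥ Pi.single j 1) := by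
    have h1 : ∑ i, ∑ j, (J * M) i j • (single i j 1 : Matrix ι ι ℝ) = J * M := by
      conv_rhs => rw [matrix_eq_sum_single (J * M)]
      simp
    have h2 : ∑ i, ∑ j, (J * M) i j • (single j i 1 : Matrix ι ι ℝ) = -(J * M) := by
      rw [← hS, Finset.sum_comm]
      conv_rhs => rw [matrix_eq_sum_single (J * M)ᵀ]
      simp
    have h3 : ∑ i, ∑ j, (J * M) i j • wedge J (J *ᵥ Pi.single i 1) (J *ᵥ Pi.single j 1) =
        J * (∑ i, ∑ j, (J * M) i j • (single i j 1 : Matrix ι ι ℝ) -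
          ∑ i, ∑ j, (J * M) i j • (single j i 1 : Matrix ι ι ℝ)) := by
      simp only [hw, ← Finset.sum_sub_distrib, ← smul_sub, Finset.mul_sum, Matrix.mul_smul]
    rw [h3, h1, h2, sub_neg_eq_add, ← two_smul ℝ (J * M), Matrix.mul_smul, ← mul_assoc, hJJ,
      one_mul, smul_smul]
    norm_num
  rw [hsum]
  exact H.smul_mem _ (H.sum_mem fun i _ => H.sum_mem fun j _ => H.smul_mem _ (hH i j))

end Wedge

section Coordinates

variable {p q : ℕ}

/-- The first null coordinate vector. -/
def nullFst (p q : ℕ) : BigIdx p q → ℝ := Pi.single (Sum.inl (Sum.inl 0)) 1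

/-- The second null coordinate vector. -/
def nullSnd (p q : ℕ) : BigIdx p q → ℝ := Pi.single (Sum.inr 0) 1

/-- The combination of the null coordinate vectors with coefficients `-c` and `1`. -/
def nullVec (p q : ℕ) (c : ℝ) : BigIdx p q → ℝ := nullSnd p q + (-c) • nullFst p q

/-- The coordinate vectors of `ℝᵖ`. -/
def vecP (q : ℕ) (i : Fin p) : BigIdx p q → ℝ := Pi.single (Sum.inl (Sum.inr (Sum.inl i))) 1

/-- The coordinate vectors of `ℝ^q`. -/
def vecQ (p : ℕ) (j : Fin q) : BigIdx p q → ℝ := Pi.single (Sum.inl (Sum.inr (Sum.inr j))) 1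

theorem sgn_mul_self (s' : ℝ) : sgn s' * sgn s' = 1 := by
  unfold sgn
  split_ifs <;> norm_num

theorem sgn_ne_zero (s' : ℝ) : sgn s' ≠ 0 := by
  unfold sgn
  split_ifs <;> norm_num

theorem JMat_transpose (p q : ℕ) (s' : ℝ) : (JMat p q s')ᵀ = JMat p q s' := by
  ext i j
  rcases i with (i | i | i) | i <;> rcases j with (j | j | j) | j <;>
    simp [JMat, gMat, one_apply, eq_comm]

theorem JMat_mulVec_nullFst (s' : ℝ) : JMat p q s' *ᵥ nullFst p q = nullSnd p q := by
  ext i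
  rcases i with (i | i | i) | i <;>
    simp [JMat, gMat, nullFst, nullSnd, Pi.single_apply, eq_iff_true_of_subsingleton]

theorem JMat_mulVec_nullSnd (s' : ℝ) : JMat p q s' *ᵥ nullSnd p q = nullFst p q := by
  ext i
  rcases i with (i | i | i) | i <;>
    simp [JMat, gMat, nullFst, nullSnd, Pi.single_apply, eq_iff_true_of_subsingleton]

theorem JMat_mulVec_vecP (s' : ℝ) (k : Fin p) : JMat p q s' *ᵥ vecP q k = vecP q k := by
  ext i
  rcases i with (i | i | i) | i <;>
    simp [JMat, gMat, vecP, Pi.single_apply, one_apply]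

theorem JMat_mulVec_vecQ (s' : ℝ) (k : Fin q) :
    JMat p q s' *ᵥ vecQ p k = sgn s' • vecQ p k := by
  ext i
  rcases i with (i | i | i) | i <;>
    simp [JMat, gMat, vecQ, Pi.single_apply, one_apply]

theorem JMat_mul_self (p q : ℕ) (s' : ℝ) : JMat p q s' * JMat p q s' = 1 := by
  refine ext_of_mulVec_single fun i => ?_
  rw [← mulVec_mulVec, one_mulVec]
  rcases i with (i | i | i) | i
  · obtain rfl := Subsingleton.elim i 0
    change JMat p q s' *ᵥ JMat p q s' *ᵥ nullFst p q = nullFst p q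
    rw [JMat_mulVec_nullFst, JMat_mulVec_nullSnd]
  · change JMat p q s' *ᵥ JMat p q s' *ᵥ vecP q i = vecP q i
    rw [JMat_mulVec_vecP, JMat_mulVec_vecP]
  · change JMat p q s' *ᵥ JMat p q s' *ᵥ vecQ p i = vecQ p i
    rw [JMat_mulVec_vecQ, mulVec_smul, JMat_mulVec_vecQ, smul_smul, sgn_mul_self, one_smul]
  · obtain rfl := Subsingleton.elim i 0
    change JMat p q s' *ᵥ JMat p q s' *ᵥ nullSnd p q = nullSnd p q
    rw [JMat_mulVec_nullSnd, JMat_mulVec_nullFst]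

/-- The eigenvalue of `𝔸` on `ℝᵖ`. -/
def rhoP (p q : ℕ) (s s' : ℝ) : ℝ :=
  -(1 / (2 * (((p : ℝ) + (q : ℝ) - 1) * ((p : ℝ) + (q : ℝ) - 2)))) *
    (2 * s * (((p : ℝ) - 1) * ((q : ℝ) - 1)) +
      (s * p * ((p : ℝ) - 1) - s' * q * ((q : ℝ) - 1)))

/-- The eigenvalue of `𝐠𝔸` on `ℝ^q`. -/
def rhoQ (p q : ℕ) (s s' : ℝ) : ℝ :=
  -(1 / (2 * (((p : ℝ) + (q : ℝ) - 1) * ((p : ℝ) + (q : ℝ) - 2)))) *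
    (2 * s' * (((p : ℝ) - 1) * ((q : ℝ) - 1)) -
      (s * p * ((p : ℝ) - 1) - s' * q * ((q : ℝ) - 1)))

theorem AMat_eq (p q : ℕ) (s s' : ℝ) :
    AMat p q s s' = fromBlocks (rhoP p q s s' • 1) 0 0 ((sgn s' * rhoQ p q s s') • 1) := by
  simp only [AMat, fromBlocks_smul, fromBlocks_add, smul_zero, add_zero, zero_add, smul_smul,
    rhoP, rhoQ]
  congr 2
  ring

theorem rhoP_add_rhoQ_ne_zero (hp : 2 ≤ p) (hq : 2 ≤ q) {s s' : ℝ} (h : s' ≠ -s) :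
    rhoP p q s s' + rhoQ p q s s' ≠ 0 := by
  have hp' : (2 : ℝ) ≤ p := by exact_mod_cast hp
  have hq' : (2 : ℝ) ≤ q := by exact_mod_cast hq
  have h1 : (p : ℝ) + q - 1 ≠ 0 := by linarith
  have h2 : (p : ℝ) + q - 2 ≠ 0 := by linarith
  have h3 : (p : ℝ) - 1 ≠ 0 := by linarith
  have h4 : (q : ℝ) - 1 ≠ 0 := by linarith
  have h5 : s + s' ≠ 0 := fun h5 => h (by linarith)
  have : rhoP p q s s' + rhoQ p q s s' =
      -((((p : ℝ) - 1) * (q - 1) * (s + s')) / ((p + q - 1) * (p + q - 2))) := by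
    unfold rhoP rhoQ
    field_simp
    ring
  rw [this]
  exact neg_ne_zero.2 (div_ne_zero (mul_ne_zero (mul_ne_zero h3 h4) h5) (mul_ne_zero h1 h2))

theorem rhoP_sub_rhoQ_ne_zero (hp : 2 ≤ p) (hq : 2 ≤ q) {s s' : ℝ}
    (h : s' ≠ (((p : ℝ) - 1) / ((q : ℝ) - 1)) * s) :
    rhoP p q s s' - rhoQ p q s s' ≠ 0 := by
  have hp' : (2 : ℝ) ≤ p := by exact_mod_cast hp
  have hq' : (2 : ℝ) ≤ q := by exact_mod_cast hq
  have h1 : (p : ℝ) + q - 1 ≠ 0 := by linarith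
  have h2 : (p : ℝ) + q - 2 ≠ 0 := by linarith
  have h4 : (q : ℝ) - 1 ≠ 0 := by linarith
  have h5 : s * (p - 1) - s' * (q - 1) ≠ 0 := fun h5 => h (by field_simp; linarith)
  have : rhoP p q s s' - rhoQ p q s s' = -((s * (p - 1) - s' * (q - 1)) / (p + q - 2)) := by
    unfold rhoP rhoQ
    field_simp
    ring
  rw [this]
  exact neg_ne_zero.2 (div_ne_zero h5 h2)

/-- The rotation generator in `so(m + 1)` with `ℝᵐ`-component `r` times
the `i`-th coordinate vector. -/
def planeRotation {m : ℕ} (r : ℝ) (i : Fin m) : Matrix (Fin 1 ⊕ Fin m) (Fin 1 ⊕ Fin m) ℝ :=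
  single (Sum.inr i) (Sum.inl 0) r - single (Sum.inl 0) (Sum.inr i) r

theorem planeRotation_transpose {m : ℕ} (r : ℝ) (i : Fin m) :
    (planeRotation r i)ᵀ = -planeRotation r i := by
  simp [planeRotation]

theorem vPart_planeRotation {m : ℕ} (r : ℝ) (i : Fin m) :
    vPart (planeRotation r i) = Pi.single i r := by
  ext j
  simp [vPart, planeRotation, single_apply, Pi.single_apply, eq_comm]

theorem toBlocks₂₂_planeRotation {m : ℕ} (r : ℝ) (i : Fin m) :
    toBlocks₂₂ (planeRotation r i) = 0 := by
  ext j k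
  simp [toBlocks₂₂, planeRotation]

theorem alphaMap_zero (p q : ℕ) (s s' : ℝ) : alphaMap p q s s' 0 = 0 := by
  have hx : xVec p q s s' 0 = 0 := by
    ext i
    rcases i with i | i <;> simp [xVec, vPart]
  ext i j
  rcases i with (i | i | i) | i <;> rcases j with (j | j | j) | j <;>
    simp [alphaMap, hx, toBlocks₂₂]

theorem alphaMap_planeRotation_left {s : ℝ} (s' : ℝ) (hs : 0 < s) (i : Fin p) :
    alphaMap p q s s' (planeRotation (√s) i, 0) =
      wedge (JMat p q s') (vecP q i) (nullVec p q (rhoP p q s s')) := by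
  have h0 : toBlocks₂₂ (0 : Matrix (Fin 1 ⊕ Fin q) (Fin 1 ⊕ Fin q) ℝ) = 0 := rfl
  have hx : xVec p q s s' (planeRotation (√s) i, 0) = Pi.single (Sum.inl i) 1 := by
    have := (Real.sqrt_pos.2 hs).ne'
    ext k
    rcases k with k | k
    · by_cases h : k = i <;> simp [xVec, vPart_planeRotation, Pi.single_apply, h, this]
    · simp [xVec, vPart]
  simp only [wedge, nullVec, mulVec_add, mulVec_smul, JMat_mulVec_nullFst, JMat_mulVec_nullSnd,
    JMat_mulVec_vecP]
  ext a b
  rcases a with (a | a | a) | a <;> rcases b with (b | b | b) | b <;>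
    simp [alphaMap, hx, toBlocks₂₂_planeRotation, AMat_eq, gMat, fromBlocks_multiply,
      vecMulVec_apply, vecP, nullFst, nullSnd, Pi.single_apply, one_apply, h0,
      eq_iff_true_of_subsingleton]
  all_goals grind

theorem alphaMap_planeRotation_right (s : ℝ) {s' : ℝ} (hs' : s' ≠ 0) (j : Fin q) :
    alphaMap p q s s' (0, planeRotation (√|s'|) j) =
      wedge (JMat p q s') (vecQ p j) (nullVec p q (rhoQ p q s s')) := by
  have h0 : toBlocks₂₂ (0 : Matrix (Fin 1 ⊕ Fin p) (Fin 1 ⊕ Fin p) ℝ) = 0 := rfl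
  have hx : xVec p q s s' (0, planeRotation (√|s'|) j) = Pi.single (Sum.inr j) 1 := by
    have := (Real.sqrt_pos.2 (abs_pos.2 hs')).ne'
    ext k
    rcases k with k | k
    · simp [xVec, vPart]
    · by_cases h : k = j <;> simp [xVec, vPart_planeRotation, Pi.single_apply, h, this]
  simp only [wedge, nullVec, mulVec_add, mulVec_smul, JMat_mulVec_nullFst, JMat_mulVec_nullSnd,
    JMat_mulVec_vecQ]
  ext a b
  rcases a with (a | a | a) | a <;> rcases b with (b | b | b) | b <;>
    simp [alphaMap, hx, toBlocks₂₂_planeRotation, AMat_eq, gMat, fromBlocks_multiply,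
      vecMulVec_apply, vecQ, nullFst, nullSnd, Pi.single_apply, one_apply, h0,
      eq_iff_true_of_subsingleton]
  all_goals grind [sgn_mul_self s']

theorem alphaMap_skew (s s' : ℝ) {X : HElt p q} (hX : skewPair p q X) :
    (alphaMap p q s s' X)ᵀ * JMat p q s' + JMat p q s' * alphaMap p q s s' X = 0 := by
  have h1 (i j) : X.1 (Sum.inr j) (Sum.inr i) = -X.1 (Sum.inr i) (Sum.inr j) :=
    congrFun (congrFun hX.1 (Sum.inr i)) (Sum.inr j)
  have h2 (i j) : X.2 (Sum.inr j) (Sum.inr i) = -X.2 (Sum.inr i) (Sum.inr j) :=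
    congrFun (congrFun hX.2 (Sum.inr i)) (Sum.inr j)
  have h3 := sgn_mul_self s'
  simp only [alphaMap, AMat_eq]
  generalize xVec p q s s' X = x
  ext a b
  rcases a with (a | a | a) | a <;> rcases b with (b | b | b) | b <;>
    simp [mul_apply, JMat, gMat, Fintype.sum_sum_type, one_apply, toBlocks₂₂, fromBlocks_multiply,
      vecMul_fromBlocks, fromBlocks_mulVec, vecMul_smul, smul_mulVec]
  all_goals grind

theorem skewPair_hBracket {X Y : HElt p q} (hX : skewPair p q X) (hY : skewPair p q Y) :
    skewPair p q (hBracket p q X Y) := by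
  constructor <;>
    simp [hBracket, transpose_sub, transpose_mul, hX.1, hX.2, hY.1, hY.2]

theorem skewPair_planeRotation_left (r : ℝ) (i : Fin p) :
    skewPair p q (planeRotation r i, 0) :=
  ⟨planeRotation_transpose r i, by simp⟩

theorem skewPair_planeRotation_right (r : ℝ) (j : Fin q) :
    skewPair p q (0, planeRotation r j) :=
  ⟨by simp, planeRotation_transpose r j⟩

theorem dotProduct_nullFst_nullFst : nullFst p q ⬝ᵥ nullFst p q = 1 := by simp [nullFst]

theorem dotProduct_nullSnd_nullSnd : nullSnd p q ⬝ᵥ nullSnd p q = 1 := by simp [nullSnd]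

theorem dotProduct_nullFst_nullSnd : nullFst p q ⬝ᵥ nullSnd p q = 0 := by
  simp [nullFst, nullSnd]

theorem dotProduct_nullFst_vecP (i : Fin p) : nullFst p q ⬝ᵥ vecP q i = 0 := by
  simp [nullFst, vecP]

theorem dotProduct_nullFst_vecQ (j : Fin q) : nullFst p q ⬝ᵥ vecQ p j = 0 := by
  simp [nullFst, vecQ]

theorem dotProduct_nullSnd_vecP (i : Fin p) : nullSnd p q ⬝ᵥ vecP q i = 0 := by
  simp [nullSnd, vecP]

theorem dotProduct_nullSnd_vecQ (j : Fin q) : nullSnd p q ⬝ᵥ vecQ p j = 0 := by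
  simp [nullSnd, vecQ]

theorem dotProduct_vecP_vecQ (i : Fin p) (j : Fin q) : vecP q i ⬝ᵥ vecQ p j = 0 := by
  simp [vecP, vecQ]

theorem dotProduct_vecP_vecP (i k : Fin p) :
    vecP q i ⬝ᵥ vecP q k = if i = k then 1 else 0 := by
  simp [vecP, Pi.single_apply, eq_comm]

theorem dotProduct_vecQ_vecQ (i k : Fin q) :
    vecQ p i ⬝ᵥ vecQ p k = if i = k then 1 else 0 := by
  simp [vecQ, Pi.single_apply, eq_comm]

theorem JMat_mulVec_nullVec (s' c : ℝ) :
    JMat p q s' *ᵥ nullVec p q c = nullFst p q + (-c) • nullSnd p q := by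
  simp only [nullVec, mulVec_add, mulVec_smul, JMat_mulVec_nullFst, JMat_mulVec_nullSnd]

theorem JMat_mulVec_nullVec_dotProduct_nullVec (s' c d : ℝ) :
    (JMat p q s' *ᵥ nullVec p q c) ⬝ᵥ nullVec p q d = -(c + d) := by
  rw [JMat_mulVec_nullVec]
  simp only [nullVec, add_dotProduct, smul_dotProduct, dotProduct_add, dotProduct_smul,
    dotProduct_comm (nullSnd p q) (nullFst p q), dotProduct_nullFst_nullFst,
    dotProduct_nullFst_nullSnd, dotProduct_nullSnd_nullSnd, smul_eq_mul]
  ring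

theorem JMat_mulVec_nullVec_dotProduct_nullFst (s' c : ℝ) :
    (JMat p q s' *ᵥ nullVec p q c) ⬝ᵥ nullFst p q = 1 := by
  rw [JMat_mulVec_nullVec]
  simp [dotProduct_comm (nullSnd p q) (nullFst p q), dotProduct_nullFst_nullFst,
    dotProduct_nullFst_nullSnd]

theorem JMat_mulVec_nullVec_dotProduct_nullSnd (s' c : ℝ) :
    (JMat p q s' *ᵥ nullVec p q c) ⬝ᵥ nullSnd p q = -c := by
  rw [JMat_mulVec_nullVec]
  simp [dotProduct_nullSnd_nullSnd, dotProduct_nullFst_nullSnd]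

theorem JMat_mulVec_nullVec_dotProduct_vecP (s' c : ℝ) (i : Fin p) :
    (JMat p q s' *ᵥ nullVec p q c) ⬝ᵥ vecP q i = 0 := by
  rw [JMat_mulVec_nullVec]
  simp [dotProduct_nullSnd_vecP, dotProduct_nullFst_vecP]

theorem JMat_mulVec_nullVec_dotProduct_vecQ (s' c : ℝ) (j : Fin q) :
    (JMat p q s' *ᵥ nullVec p q c) ⬝ᵥ vecQ p j = 0 := by
  rw [JMat_mulVec_nullVec]
  simp [dotProduct_nullSnd_vecQ, dotProduct_nullFst_vecQ]

theorem wedge_nullVec_right (J : Matrix (BigIdx p q) (BigIdx p q) ℝ) (u : BigIdx p q → ℝ)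
    (c : ℝ) :
    wedge J u (nullVec p q c) = wedge J u (nullSnd p q) - c • wedge J u (nullFst p q) := by
  rw [nullVec, wedge_add_right, wedge_smul_right, neg_smul, sub_eq_add_neg]

/-- Commutator of the connection in a direction tangent to `Sᵖ` with a wedge. -/
theorem commutator_wedge_vecP (s' c : ℝ) (i : Fin p) (x y : BigIdx p q → ℝ) :
    wedge (JMat p q s') (vecP q i) (nullVec p q c) * wedge (JMat p q s') x y -
        wedge (JMat p q s') x y * wedge (JMat p q s') (vecP q i) (nullVec p q c) =
      ((JMat p q s' *ᵥ nullVec p q c) ⬝ᵥ x) • wedge (JMat p q s') (vecP q i) y -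
        (vecP q i ⬝ᵥ x) • wedge (JMat p q s') (nullVec p q c) y +
      (((JMat p q s' *ᵥ nullVec p q c) ⬝ᵥ y) • wedge (JMat p q s') x (vecP q i) -
        (vecP q i ⬝ᵥ y) • wedge (JMat p q s') x (nullVec p q c)) := by
  rw [commutator_wedge_wedge (JMat_transpose p q s')]
  simp only [JMat_mulVec_vecP, sub_eq_add_neg, ← neg_smul, wedge_add_left, wedge_add_right,
    wedge_smul_left, wedge_smul_right]

/-- Commutator of the connection in a direction tangent to `S^q` with a wedge. -/
theorem commutator_wedge_vecQ (s' c : ℝ) (j : Fin q) (x y : BigIdx p q → ℝ) :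
    wedge (JMat p q s') (vecQ p j) (nullVec p q c) * wedge (JMat p q s') x y -
        wedge (JMat p q s') x y * wedge (JMat p q s') (vecQ p j) (nullVec p q c) =
      ((JMat p q s' *ᵥ nullVec p q c) ⬝ᵥ x) • wedge (JMat p q s') (vecQ p j) y -
        (sgn s' * (vecQ p j ⬝ᵥ x)) • wedge (JMat p q s') (nullVec p q c) y +
      (((JMat p q s' *ᵥ nullVec p q c) ⬝ᵥ y) • wedge (JMat p q s') x (vecQ p j) -
        (sgn s' * (vecQ p j ⬝ᵥ y)) • wedge (JMat p q s') x (nullVec p q c)) := by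
  rw [commutator_wedge_wedge (JMat_transpose p q s')]
  simp only [JMat_mulVec_vecQ, smul_dotProduct, smul_eq_mul, sub_eq_add_neg, ← neg_smul,
    wedge_add_left, wedge_add_right, wedge_smul_left, wedge_smul_right]

/-- A space stable under the connection and containing the mixed curvature values contains every
matrix skew-adjoint for `J`, provided the eigenvalues `a`, `b` of `𝐠𝔸` satisfy `a ≠ ±b`. -/
theorem mem_of_commutator_mem (hp : 0 < p) (hq : 0 < q) (s' : ℝ) {a b : ℝ}
    (hadd : a + b ≠ 0) (hsub : a - b ≠ 0)
    (H : Submodule ℝ (Matrix (BigIdx p q) (BigIdx p q) ℝ))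
    (hPQ : ∀ i j, wedge (JMat p q s') (vecP q i) (nullVec p q a) *
        wedge (JMat p q s') (vecQ p j) (nullVec p q b) -
      wedge (JMat p q s') (vecQ p j) (nullVec p q b) *
        wedge (JMat p q s') (vecP q i) (nullVec p q a) ∈ H)
    (hP : ∀ i, ∀ M ∈ H, wedge (JMat p q s') (vecP q i) (nullVec p q a) * M -
      M * wedge (JMat p q s') (vecP q i) (nullVec p q a) ∈ H)
    (hQ : ∀ j, ∀ M ∈ H, wedge (JMat p q s') (vecQ p j) (nullVec p q b) * M -
      M * wedge (JMat p q s') (vecQ p j) (nullVec p q b) ∈ H)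
    {M : Matrix (BigIdx p q) (BigIdx p q) ℝ}
    (hM : Mᵀ * JMat p q s' + JMat p q s' * M = 0) : M ∈ H := by
  have hε := sgn_ne_zero s'
  have hadd' : b + a ≠ 0 := by rwa [add_comm]
  have hJP (x y) (i : Fin p) (h : wedge (JMat p q s') x y ∈ H) := hP i _ h
  have hJQ (x y) (j : Fin q) (h : wedge (JMat p q s') x y ∈ H) := hQ j _ h
  simp only [commutator_wedge_vecP, commutator_wedge_vecQ] at hPQ hJP hJQ
  have hswap {x y} (h : wedge (JMat p q s') x y ∈ H) : wedge (JMat p q s') y x ∈ H := by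
    rw [wedge_swap]
    exact H.neg_mem h
  have hcancel {c : ℝ} (hc : c ≠ 0) {N} (h : c • N ∈ H) : N ∈ H :=
    (H.smul_mem_iff hc).1 h
  have hPnull (i : Fin p) (c : ℝ) : vecP q i ⬝ᵥ nullVec p q c = 0 := by
    simp [nullVec, dotProduct_comm (vecP q i), dotProduct_nullFst_vecP, dotProduct_nullSnd_vecP]
  have hQnull (j : Fin q) (c : ℝ) : vecQ p j ⬝ᵥ nullVec p q c = 0 := by
    simp [nullVec, dotProduct_comm (vecQ p j), dotProduct_nullFst_vecQ, dotProduct_nullSnd_vecQ]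
  have hQP (j : Fin q) (i : Fin p) : vecQ p j ⬝ᵥ vecP q i = 0 := by
    rw [dotProduct_comm, dotProduct_vecP_vecQ]
  have hvQvP (j : Fin q) (i : Fin p) : wedge (JMat p q s') (vecQ p j) (vecP q i) ∈ H := by
    have := hPQ i j
    simp only [JMat_mulVec_nullVec_dotProduct_vecQ, dotProduct_vecP_vecQ, hPnull,
      JMat_mulVec_nullVec_dotProduct_nullVec, zero_smul, sub_zero, zero_add] at this
    exact hcancel (neg_ne_zero.2 hadd) this
  have hvQnull (j : Fin q) : wedge (JMat p q s') (vecQ p j) (nullVec p q a) ∈ H := by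
    have := hJP _ _ ⟨0, hp⟩ (hvQvP j ⟨0, hp⟩)
    simpa [JMat_mulVec_nullVec_dotProduct_vecQ, JMat_mulVec_nullVec_dotProduct_vecP,
      dotProduct_vecP_vecQ, dotProduct_vecP_vecP] using this
  have hvPnull (i : Fin p) : wedge (JMat p q s') (vecP q i) (nullVec p q b) ∈ H := by
    have := hJQ _ _ ⟨0, hq⟩ (hvQvP ⟨0, hq⟩ i)
    simp only [JMat_mulVec_nullVec_dotProduct_vecQ, JMat_mulVec_nullVec_dotProduct_vecP,
      hQP, dotProduct_vecQ_vecQ, if_true, mul_one, mul_zero, zero_smul, sub_zero, add_zero,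
      zero_sub, ← neg_smul] at this
    exact hswap (hcancel (neg_ne_zero.2 hε) this)
  have hnull : wedge (JMat p q s') (nullFst p q) (nullSnd p q) ∈ H := by
    have := hJQ _ _ ⟨0, hq⟩ (hvQnull ⟨0, hq⟩)
    simp only [JMat_mulVec_nullVec_dotProduct_vecQ, JMat_mulVec_nullVec_dotProduct_nullVec,
      hQnull, dotProduct_vecQ_vecQ, if_true, mul_one, mul_zero, zero_smul, sub_zero, add_zero,
      zero_sub, wedge_self, smul_zero, ← neg_smul] at this
    have h := hcancel (neg_ne_zero.2 hε) this
    rw [wedge_nullVec_right, wedge_swap _ (nullVec p q b) (nullSnd p q), wedge_nullVec_right,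
      wedge_swap _ (nullVec p q b) (nullFst p q), wedge_nullVec_right, wedge_self, wedge_self,
      wedge_swap _ (nullSnd p q)] at h
    refine hcancel hsub ?_
    convert h using 1
    module
  have hvQvQ (j k : Fin q) : wedge (JMat p q s') (vecQ p j) (vecQ p k) ∈ H := by
    rcases eq_or_ne k j with rfl | hjk
    · simp [wedge_self]
    have := hJQ _ _ k (hvQnull j)
    simp only [JMat_mulVec_nullVec_dotProduct_vecQ, JMat_mulVec_nullVec_dotProduct_nullVec,
      hQnull, dotProduct_vecQ_vecQ, hjk, if_false, mul_zero, zero_smul, sub_zero,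
      zero_add] at this
    exact hcancel (neg_ne_zero.2 hadd') this
  have hvPvP (i k : Fin p) : wedge (JMat p q s') (vecP q i) (vecP q k) ∈ H := by
    rcases eq_or_ne k i with rfl | hik
    · simp [wedge_self]
    have := hJP _ _ k (hvPnull i)
    simp only [JMat_mulVec_nullVec_dotProduct_vecP, JMat_mulVec_nullVec_dotProduct_nullVec,
      hPnull, dotProduct_vecP_vecP, hik, if_false, zero_smul, sub_zero, zero_add] at this
    exact hcancel (neg_ne_zero.2 hadd) this
  have hvPFst (i : Fin p) : wedge (JMat p q s') (vecP q i) (nullFst p q) ∈ H := by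
    have h1 := hJP _ _ i hnull
    simp only [JMat_mulVec_nullVec_dotProduct_nullFst, JMat_mulVec_nullVec_dotProduct_nullSnd,
      dotProduct_comm (vecP q i), dotProduct_nullFst_vecP, dotProduct_nullSnd_vecP,
      zero_smul, sub_zero] at h1
    have h2 := hvPnull i
    rw [wedge_nullVec_right] at h2
    refine hcancel hadd ?_
    convert H.sub_mem h1 h2 using 1
    rw [wedge_swap _ (nullFst p q)]
    module
  have hvQFst (j : Fin q) : wedge (JMat p q s') (vecQ p j) (nullFst p q) ∈ H := by
    have h1 := hJQ _ _ j hnull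
    simp only [JMat_mulVec_nullVec_dotProduct_nullFst, JMat_mulVec_nullVec_dotProduct_nullSnd,
      dotProduct_comm (vecQ p j), dotProduct_nullFst_vecQ, dotProduct_nullSnd_vecQ,
      mul_zero, zero_smul, sub_zero] at h1
    have h2 := hvQnull j
    rw [wedge_nullVec_right] at h2
    refine hcancel hadd ?_
    convert H.sub_mem h1 h2 using 1
    rw [wedge_swap _ (nullFst p q)]
    module
  have hvPSnd (i : Fin p) : wedge (JMat p q s') (vecP q i) (nullSnd p q) ∈ H := by
    have h := hvPnull i
    rw [wedge_nullVec_right] at h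
    exact (H.sub_mem_iff_left (H.smul_mem b (hvPFst i))).1 h
  have hvQSnd (j : Fin q) : wedge (JMat p q s') (vecQ p j) (nullSnd p q) ∈ H := by
    have h := hvQnull j
    rw [wedge_nullVec_right] at h
    exact (H.sub_mem_iff_left (H.smul_mem a (hvQFst j))).1 h
  have hFst (k : Fin 1) : JMat p q s' *ᵥ Pi.single (Sum.inl (Sum.inl k)) 1 = nullSnd p q := by
    rw [Subsingleton.elim k 0]
    exact JMat_mulVec_nullFst s'
  have hSnd (k : Fin 1) : JMat p q s' *ᵥ Pi.single (Sum.inr k) 1 = nullFst p q := by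
    rw [Subsingleton.elim k 0]
    exact JMat_mulVec_nullSnd s'
  have hvP (i : Fin p) :
      JMat p q s' *ᵥ Pi.single (Sum.inl (Sum.inr (Sum.inl i))) 1 = vecP q i :=
    JMat_mulVec_vecP s' i
  have hvQ (j : Fin q) :
      JMat p q s' *ᵥ Pi.single (Sum.inl (Sum.inr (Sum.inr j))) 1 = sgn s' • vecQ p j :=
    JMat_mulVec_vecQ s' j
  refine mem_of_wedge_mem (JMat_transpose p q s') (JMat_mul_self p q s') H (fun u v => ?_) hM
  rcases u with (u | u | u) | u <;> rcases v with (v | v | v) | v <;>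
    simp only [hFst, hSnd, hvP, hvQ, wedge_smul_left, wedge_smul_right, wedge_self,
      H.zero_mem, H.smul_mem_iff hε, hvPvP, hvQvQ, hvQvP, hswap (hvQvP _ _), hnull, hswap hnull,
      hvPFst, hvQFst, hvPSnd, hvQSnd, hswap (hvPFst _), hswap (hvQFst _), hswap (hvPSnd _),
      hswap (hvQSnd _)]

end Coordinates

/-- **For a generic ratio of radii, the conformal holonomy of `Sᵖ × S^q` is full**
(Wang-holonomy form): for `p, q ≥ 2` and `s' ∉ {−s, ((p−1)/(q−1))·s}`, the smallest
linear subspace of `M_{n+2}(ℝ)` containing all curvature values `κ(X,Y)` and invariant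
under `M ↦ [α(Z), M]` for every `Z ∈ 𝔥` equals all of `𝔤 = so(J)`
(which is `so(p+q+1,1)` for `s' > 0` and `so(p+1,q+1)` for `s' < 0`). -/
theorem conformal_holonomy_generic_case (p q : ℕ) (hp : 2 ≤ p) (hq : 2 ≤ q)
    (s s' : ℝ) (hs : 0 < s) (hs'0 : s' ≠ 0)
    (hs'1 : s' ≠ -s) (hs'2 : s' ≠ (((p : ℝ) - 1) / ((q : ℝ) - 1)) * s)
    (H : Submodule ℝ (Matrix (BigIdx p q) (BigIdx p q) ℝ))
    (hHκ : ∀ X Y : HElt p q, skewPair p q X → skewPair p q Y → kappaMap p q s s' X Y ∈ H)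
    (hHinv : ∀ Z : HElt p q, skewPair p q Z → ∀ M ∈ H,
      alphaMap p q s s' Z * M - M * alphaMap p q s s' Z ∈ H)
    (hHmin : ∀ N : Submodule ℝ (Matrix (BigIdx p q) (BigIdx p q) ℝ),
      (∀ X Y : HElt p q, skewPair p q X → skewPair p q Y → kappaMap p q s s' X Y ∈ N) →
      (∀ Z : HElt p q, skewPair p q Z → ∀ M ∈ N,
        alphaMap p q s s' Z * M - M * alphaMap p q s s' Z ∈ N) →
      H ≤ N) :
    (H : Set (Matrix (BigIdx p q) (BigIdx p q) ℝ)) =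
      {M | Mᵀ * JMat p q s' + JMat p q s' * M = 0} := by
  have hL := fun i : Fin p => alphaMap_planeRotation_left (q := q) s' hs i
  have hR := fun j : Fin q => alphaMap_planeRotation_right (p := p) s hs'0 j
  apply Set.Subset.antisymm
  · let N := skewAdjointMatricesSubmodule (JMat p q s')
    have hN (M) : M ∈ N ↔ Mᵀ * JMat p q s' + JMat p q s' * M = 0 := by
      rw [mem_skewAdjointMatricesSubmodule, Matrix.IsSkewAdjoint, Matrix.IsAdjointPair, mul_neg,
        eq_neg_iff_add_eq_zero]
    have hα (X) (hX : skewPair p q X) : alphaMap p q s s' X ∈ N :=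
      (hN _).2 (alphaMap_skew s s' hX)
    have hcomm (A B) (hA : A ∈ N) (hB : B ∈ N) : A * B - B * A ∈ N :=
      (hN _).2 (commutator_skew ((hN A).1 hA) ((hN B).1 hB))
    intro M hM
    exact (hN M).1 (hHmin N
      (fun X Y hX hY => N.sub_mem (hcomm _ _ (hα X hX) (hα Y hY))
        (hα _ (skewPair_hBracket hX hY)))
      (fun Z hZ M hM => hcomm _ _ (hα Z hZ) hM) hM)
  · intro M hM
    refine mem_of_commutator_mem (by omega) (by omega) s' (rhoP_add_rhoQ_ne_zero hp hq hs'1)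
      (rhoP_sub_rhoQ_ne_zero hp hq hs'2) H (fun i j => ?_) (fun i M hM => ?_) (fun j M hM => ?_) hM
    · have h := hHκ _ _ (skewPair_planeRotation_left (q := q) (√s) i)
        (skewPair_planeRotation_right (p := p) (√|s'|) j)
      have h0 : hBracket p q (planeRotation (√s) i, 0) (0, planeRotation (√|s'|) j) = 0 := by
        simp [hBracket]
      rwa [kappaMap, h0, alphaMap_zero, sub_zero, hL, hR] at h
    · rw [← hL]
      exact hHinv _ (skewPair_planeRotation_left _ i) M hM
    · rw [← hR]
      exact hHinv _ (skewPair_planeRotation_right _ j) M hM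

end
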